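/- Let L be a layer on n channels, let L⁰ be L with all comparators also occurring in F_n removed, and suppose L¹ = L⁰ ∪ {⟨i,j⟩} is a layer where i ≤ ⌊n/2⌋ is a min-channel of F_n, j ≥ ⌈n/2⌉+1 is a max-channel of F_n, and ⟨i,j⟩ ∉ F_n. Then outputs(F_n ⨟ L¹) ⊆ outputs(F_n ⨟ L⁰) = outputs(F_n ⨟ L). -/

import Mathlib

/-- A comparator on `n` channels: an ordered pair of channel indices
(the first component receives the minimum, the second the maximum). -/
abbrev Comparator (n : ℕ) : Type := Fin n × Fin n

/-- A layer of a comparator network: a list of comparators. -/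
abbrev Layer (n : ℕ) : Type := List (Comparator n)

/-- A comparator network: a list of layers; its depth is the length of this list. -/
abbrev Network (n : ℕ) : Type := List (Layer n)

/-- Two comparators are channel-disjoint if they share no channel. -/
def ChDisjoint {n : ℕ} (c d : Comparator n) : Prop :=
  c.1 ≠ d.1 ∧ c.1 ≠ d.2 ∧ c.2 ≠ d.1 ∧ c.2 ≠ d.2

/-- A valid (ordinary) layer: every comparator `⟨i,j⟩` satisfies `i < j`
and every channel occurs at most once in the layer. -/
def IsLayer {n : ℕ} (L : Layer n) : Prop :=
  (∀ c ∈ L, c.1 < c.2) ∧ L.Pairwise ChDisjoint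

/-- A valid (ordinary) comparator network: all its layers are valid layers. -/
def IsNetwork {n : ℕ} (C : Network n) : Prop := ∀ L ∈ C, IsLayer L

/-- Applying the comparator `c = ⟨i,j⟩` to a vector of values:
channel `i` receives the minimum and channel `j` the maximum of the
values on channels `i` and `j`; all other channels are unchanged. -/
def applyComparator {n : ℕ} {α : Type*} [LinearOrder α] (c : Comparator n)
    (v : Fin n → α) : Fin n → α := fun k =>
  if k = c.1 then min (v c.1) (v c.2)
  else if k = c.2 then max (v c.1) (v c.2)
  else v k

/-- Applying a layer: apply all its comparators (they act on disjoint channels). -/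
def applyLayer {n : ℕ} {α : Type*} [LinearOrder α] (L : Layer n)
    (v : Fin n → α) : Fin n → α :=
  L.foldl (fun w c => applyComparator c w) v

/-- Applying a network: apply its layers in sequence; `applyNetwork C x` is `C(x)`. -/
def applyNetwork {n : ℕ} {α : Type*} [LinearOrder α] (C : Network n)
    (v : Fin n → α) : Fin n → α :=
  C.foldl (fun w L => applyLayer L w) v

/-- The fixed maximal first layer `F_n = { ⟨i, ⌈n/2⌉ + i⟩ : 1 ≤ i ≤ ⌊n/2⌋ }`
(here written 0-indexed: comparators `⟨i, ⌈n/2⌉ + i⟩` for `0 ≤ i < ⌊n/2⌋`). -/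
def Fnet (n : ℕ) : Layer n :=
  (List.finRange n).filterMap (fun i =>
    if h : i.val < n / 2 ∧ (n + 1) / 2 + i.val < n then
      some (i, ⟨(n + 1) / 2 + i.val, h.2⟩)
    else none)

/-- The set of all possible outputs of `C` on Boolean inputs. -/
def outputs {n : ℕ} (C : Network n) : Set (Fin n → Bool) :=
  Set.range (fun x : Fin n → Bool => applyNetwork C x)

/-- `L⁰`: the layer `L` with all comparators also occurring in `F_n` removed. -/
def removeF {n : ℕ} (L : Layer n) : Layer n :=
  L.filter (fun c => decide (c ∉ Fnet n))

theorem mem_Fnet {n : ℕ} {c : Comparator n} (hc : c ∈ Fnet n) :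
    c.1.val < n / 2 ∧ c.2.val = (n + 1) / 2 + c.1.val := by
  simp only [Fnet, List.mem_filterMap] at hc
  obtain ⟨a, -, ha⟩ := hc
  split_ifs at ha with h
  obtain rfl := Option.some.inj ha
  exact ⟨h.1, rfl⟩

theorem pairwise_chDisjoint_Fnet (n : ℕ) : (Fnet n).Pairwise ChDisjoint := by
  rw [Fnet, List.pairwise_filterMap]
  refine (List.nodup_finRange n).imp ?_
  intro a b hab c hc d hd
  split_ifs at hc with h
  split_ifs at hd with h'
  obtain rfl := Option.some.inj hc
  obtain rfl := Option.some.inj hd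
  simp only [ChDisjoint, ne_eq, Fin.ext_iff] at hab ⊢
  omega

section
variable {n : ℕ} {α : Type*} [LinearOrder α]

theorem applyComparator_of_ne {c : Comparator n} {k : Fin n} (v : Fin n → α)
    (h₁ : k ≠ c.1) (h₂ : k ≠ c.2) : applyComparator c v k = v k := by
  simp [applyComparator, h₁, h₂]

theorem applyComparator_fst_le_snd (c : Comparator n) (v : Fin n → α) :
    applyComparator c v c.1 ≤ applyComparator c v c.2 := by
  by_cases h : c.2 = c.1
  · rw [h]
  · simp [applyComparator, h]

theorem applyComparator_eq_self {c : Comparator n} {v : Fin n → α} (h : v c.1 ≤ v c.2) :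
    applyComparator c v = v := by
  funext k
  unfold applyComparator
  split_ifs <;> simp_all

theorem applyComparator_le {c : Comparator n} {k : Fin n} (v : Fin n → α) (h : k ≠ c.2) :
    applyComparator c v k ≤ v k := by
  unfold applyComparator
  split_ifs <;> simp_all

theorem le_applyComparator {c : Comparator n} {k : Fin n} (v : Fin n → α) (h : k ≠ c.1) :
    v k ≤ applyComparator c v k := by
  unfold applyComparator
  split_ifs <;> simp_all

theorem applyLayer_cons (c : Comparator n) (L : Layer n) (v : Fin n → α) :
    applyLayer (c :: L) v = applyLayer L (applyComparator c v) := rfl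

theorem applyLayer_of_forall_ne {L : Layer n} {k : Fin n} (v : Fin n → α)
    (h : ∀ c ∈ L, k ≠ c.1 ∧ k ≠ c.2) : applyLayer L v k = v k := by
  induction L generalizing v with
  | nil => rfl
  | cons c L ih =>
    rw [List.forall_mem_cons] at h
    rw [applyLayer_cons, ih _ h.2, applyComparator_of_ne v h.1.1 h.1.2]

theorem applyLayer_fst_le_snd {L : Layer n} (hL : L.Pairwise ChDisjoint) (v : Fin n → α) :
    ∀ c ∈ L, applyLayer L v c.1 ≤ applyLayer L v c.2 := by
  induction L generalizing v with
  | nil => simp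
  | cons c L ih =>
    rw [List.pairwise_cons] at hL
    rw [List.forall_mem_cons, applyLayer_cons]
    refine ⟨?_, ih hL.2 _⟩
    rw [applyLayer_of_forall_ne _ fun d hd => ⟨(hL.1 d hd).1, (hL.1 d hd).2.1⟩,
      applyLayer_of_forall_ne _ fun d hd => (hL.1 d hd).2.2]
    exact applyComparator_fst_le_snd c v

theorem applyLayer_eq_self {L : Layer n} {v : Fin n → α} (h : ∀ c ∈ L, v c.1 ≤ v c.2) :
    applyLayer L v = v := by
  induction L with
  | nil => rfl
  | cons c L ih =>
    rw [List.forall_mem_cons] at h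
    rw [applyLayer_cons, applyComparator_eq_self h.1, ih h.2]

/-- Removing from a layer comparators whose inputs are already in order does not change
the result. -/
theorem applyLayer_filter {L : Layer n} (hL : L.Pairwise ChDisjoint) (p : Comparator n → Bool)
    {v : Fin n → α} (h : ∀ c ∈ L, p c = false → v c.1 ≤ v c.2) :
    applyLayer (L.filter p) v = applyLayer L v := by
  induction L generalizing v with
  | nil => rfl
  | cons c L ih =>
    rw [List.pairwise_cons] at hL
    rw [List.forall_mem_cons] at h
    cases hc : p c with
    | false =>
      rw [List.filter_cons_of_neg (by simp [hc]), applyLayer_cons,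
        applyComparator_eq_self (h.1 hc), ih hL.2 h.2]
    | true =>
      rw [List.filter_cons_of_pos hc, applyLayer_cons, applyLayer_cons]
      refine ih hL.2 fun d hd hpd => ?_
      obtain ⟨h₁, h₂, h₃, h₄⟩ := hL.1 d hd
      rw [applyComparator_of_ne v h₁.symm h₃.symm, applyComparator_of_ne v h₂.symm h₄.symm]
      exact h.2 d hd hpd

end

/-- The outputs of `F_n` are exactly the inputs ordered along every comparator of `F_n`. -/
theorem outputs_Fnet_cons {n : ℕ} (L : Layer n) :
    outputs [Fnet n, L] =
      applyLayer L '' {v : Fin n → Bool | ∀ c ∈ Fnet n, v c.1 ≤ v c.2} := by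
  ext y
  constructor
  · rintro ⟨x, rfl⟩
    exact ⟨applyLayer (Fnet n) x, applyLayer_fst_le_snd (pairwise_chDisjoint_Fnet n) x, rfl⟩
  · rintro ⟨v, hv, rfl⟩
    exact ⟨v, congrArg (applyLayer L) (applyLayer_eq_self hv)⟩

/-- let `L⁰` be `L` without the comparators of `F_n`, and let
`L¹ = L⁰ ∪ {⟨i,j⟩}` be a layer where `i` is a min-channel of `F_n`, `j` is a
max-channel of `F_n` and `⟨i,j⟩ ∉ F_n`. Then
`outputs(F_n ⨟ L¹) ⊆ outputs(F_n ⨟ L⁰) = outputs(F_n ⨟ L)`. -/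
theorem statement_11 {n : ℕ} (L : Layer n) (hL : IsLayer L) (i j : Fin n)
    (hmin : i.val < n / 2) (hmax : (n + 1) / 2 ≤ j.val)
    (hnotF : (i, j) ∉ Fnet n)
    (hL1 : IsLayer ((i, j) :: removeF L)) :
    outputs [Fnet n, (i, j) :: removeF L] ⊆ outputs [Fnet n, removeF L] ∧
    outputs [Fnet n, removeF L] = outputs [Fnet n, L] := by
  simp only [outputs_Fnet_cons]
  constructor
  · rintro _ ⟨v, hv, rfl⟩
    refine ⟨applyComparator (i, j) v, fun c hc => ?_, rfl⟩
    obtain ⟨h₁, h₂⟩ := mem_Fnet hc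
    have hj : c.1 ≠ j := by rw [ne_eq, Fin.ext_iff]; omega
    have hi : c.2 ≠ i := by rw [ne_eq, Fin.ext_iff]; omega
    exact (applyComparator_le v hj).trans ((hv c hc).trans (le_applyComparator v hi))
  · refine Set.image_congr fun v hv => applyLayer_filter hL.2 _ fun c _ hc => hv c ?_
    simpa using hc
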